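/- Let N ≥ 2 be even and let P = (P⁽¹⁾,P⁽²⁾,P⁽³⁾) be a 3-dimensional homogeneous polynomial of degree N with coefficients p_α⁽ʲ⁾ such that P is divergence-free, curl-free, each component P⁽ʲ⁾ is harmonic, and σ(ρ) divides 𝓘[P](ρ) in ℂ[ρ₁,ρ₂,ρ₃]. Then p_α⁽ʲ⁾ = 0 for every j ∈ {1,2,3} and every multi-index α with |α| = N all of whose components are even, i.e. p⁽ʲ⁾_{(2l,2n,N−2l−2n)} = 0 for all integers l, n ≥ 0 with l + n ≤ N/2. -/

import Mathlib

open MvPolynomial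

/-- The multi-index `𝟙 − e_j`, i.e. ones everywhere except at `j` where it is `0`. -/
noncomputable def onesHat (j : Fin 3) : Fin 3 →₀ ℕ :=
  ∑ i ∈ Finset.univ.erase j, Finsupp.single i 1

/-- The homogeneous polynomial `𝓘[P](ρ) = Σ_{j} Σ_{α_j=0} p_α⁽ʲ⁾ · α! · ρ^{α+𝟙−e_j}`
associated with a 3-dimensional (homogeneous) polynomial `P`. -/
noncomputable def calI (P : Fin 3 → MvPolynomial (Fin 3) ℂ) : MvPolynomial (Fin 3) ℂ :=
  ∑ j : Fin 3, ∑ α ∈ (P j).support.filter (fun α => α j = 0),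
    monomial (α + onesHat j) (coeff α (P j) * ∏ i, (Nat.factorial (α i) : ℂ))

/-- `σ(ρ) = ρ₂²ρ₃² + ρ₁²ρ₃² + ρ₁²ρ₂²`. -/
noncomputable def sigma3 : MvPolynomial (Fin 3) ℂ :=
  X 1 ^ 2 * X 2 ^ 2 + X 0 ^ 2 * X 2 ^ 2 + X 0 ^ 2 * X 1 ^ 2

theorem onesHat_apply (j i : Fin 3) : onesHat j i = if i = j then 0 else 1 := by
  fin_cases j <;> fin_cases i <;>
    simp [onesHat, Finsupp.finsetSum_apply, Finsupp.single_apply]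

theorem sigma3_eq {j k l : Fin 3} (hjk : j ≠ k) (hjl : j ≠ l) (hkl : k ≠ l) :
    sigma3 = monomial (Finsupp.single j 2 + Finsupp.single k 2) 1 +
      monomial (Finsupp.single j 2 + Finsupp.single l 2) 1 +
      monomial (Finsupp.single k 2 + Finsupp.single l 2) 1 := by
  have h (a b : Fin 3) : (monomial (Finsupp.single a 2 + Finsupp.single b 2) (1 : ℂ)) =
      X a ^ 2 * X b ^ 2 := by
    rw [X_pow_eq_monomial, X_pow_eq_monomial, monomial_mul, one_mul]
  simp only [h, sigma3]
  fin_cases j <;> fin_cases k <;> fin_cases l <;> simp at hjk hjl hkl <;> simp <;> ring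

theorem coeff_sigma3_mul {j k l : Fin 3} (hjk : j ≠ k) (hjl : j ≠ l) (hkl : k ≠ l)
    (Q : MvPolynomial (Fin 3) ℂ) (m : Fin 3 →₀ ℕ) :
    coeff m (sigma3 * Q) =
      (if Finsupp.single j 2 + Finsupp.single k 2 ≤ m then
        coeff (m - (Finsupp.single j 2 + Finsupp.single k 2)) Q else 0) +
      (if Finsupp.single j 2 + Finsupp.single l 2 ≤ m then
        coeff (m - (Finsupp.single j 2 + Finsupp.single l 2)) Q else 0) +
      (if Finsupp.single k 2 + Finsupp.single l 2 ≤ m then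
        coeff (m - (Finsupp.single k 2 + Finsupp.single l 2)) Q else 0) := by
  rw [sigma3_eq hjk hjl hkl]
  simp only [add_mul, coeff_add, coeff_monomial_mul', one_mul]

/-- Multiplication by `sigma3` respects the parity classes of exponents, so within one class a
multiple of `sigma3` that does not involve the variable `j` vanishes. -/
theorem coeff_eq_zero_of_coeff_sigma3_mul {j k l : Fin 3} (hjk : j ≠ k) (hjl : j ≠ l)
    (hkl : k ≠ l) (Q : MvPolynomial (Fin 3) ℂ)
    (hQ : ∀ m : Fin 3 →₀ ℕ, Even (m j) → Odd (m k) → Odd (m l) → 0 < m j →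
      coeff m (sigma3 * Q) = 0)
    (m : Fin 3 →₀ ℕ) (hj : Even (m j)) (hk : Odd (m k)) (hl : Odd (m l)) :
    coeff m Q = 0 := by
  induction hn : m l using Nat.strong_induction_on generalizing m with
  | _ n ih =>
    have h := hQ (m + (Finsupp.single j 2 + Finsupp.single k 2))
      (by simp [hjk, hj, parity_simps]) (by simp [hjk, hk, parity_simps])
      (by simpa [hjl.symm, hkl.symm, Finsupp.single_apply, hjl, hkl] using hl)
      (by simp)
    rw [coeff_sigma3_mul hjk hjl hkl, if_pos (by simp), add_tsub_cancel_right] at h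
    rw [Nat.even_iff] at hj
    rw [Nat.odd_iff] at hk hl
    have vanish (s : Fin 3 →₀ ℕ) (hsj : Even (s j)) (hsk : Even (s k)) (hsl : s l = 2) :
        (if s ≤ m + (Finsupp.single j 2 + Finsupp.single k 2) then
          coeff (m + (Finsupp.single j 2 + Finsupp.single k 2) - s) Q else 0) = 0 := by
      split_ifs with hs
      · have h1 := hs j
        have h2 := hs k
        have h3 := hs l
        rw [Nat.even_iff] at hsj hsk
        simp [hjk, hjl, hkl, hjk.symm] at h1 h2 h3
        refine ih (m l - 2) (by omega) _ ?_ ?_ ?_ ?_ <;>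
          simp [Nat.even_iff, Nat.odd_iff, hjk, hjl, hkl, hjk.symm, hsl] <;> omega
      · rfl
    rw [vanish, vanish] at h
    · simpa using h
    all_goals simp [hjk, hjl, hkl, hjk.symm, hjl.symm, hkl.symm]

theorem coeff_sigma3_mul_eq_zero {j k l : Fin 3} (hjk : j ≠ k) (hjl : j ≠ l)
    (hkl : k ≠ l) (Q : MvPolynomial (Fin 3) ℂ)
    (hQ : ∀ m : Fin 3 →₀ ℕ, Even (m j) → Odd (m k) → Odd (m l) → 0 < m j →
      coeff m (sigma3 * Q) = 0)
    (m : Fin 3 →₀ ℕ) (hj : Even (m j)) (hk : Odd (m k)) (hl : Odd (m l)) :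
    coeff m (sigma3 * Q) = 0 := by
  have vanish (s : Fin 3 →₀ ℕ) (hs : ∀ i, Even (s i)) :
      (if s ≤ m then coeff (m - s) Q else 0) = 0 := by
    split_ifs with hsm
    · refine coeff_eq_zero_of_coeff_sigma3_mul hjk hjl hkl Q hQ _ ?_ ?_ ?_
      · exact hj.tsub (hs j)
      · exact Nat.Odd.sub_even (hsm k) hk (hs k)
      · exact Nat.Odd.sub_even (hsm l) hl (hs l)
    · rfl
  have even_two (a b i : Fin 3) : Even ((Finsupp.single a 2 + Finsupp.single b 2 : Fin 3 →₀ ℕ) i) := by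
    simp only [Finsupp.add_apply, Finsupp.single_apply]
    split_ifs <;> decide
  rw [coeff_sigma3_mul hjk hjl hkl, vanish _ (even_two _ _), vanish _ (even_two _ _),
    vanish _ (even_two _ _), add_zero, add_zero]

theorem coeff_calI_eq_zero (P : Fin 3 → MvPolynomial (Fin 3) ℂ) {m : Fin 3 →₀ ℕ}
    (hm : ∀ i, 0 < m i) : coeff m (calI P) = 0 := by
  simp only [calI, coeff_sum, coeff_monomial]
  refine Finset.sum_eq_zero fun i _ => Finset.sum_eq_zero fun α hα => if_neg ?_
  rintro rfl
  have := hm i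
  simp [onesHat_apply, (Finset.mem_filter.1 hα).2] at this

theorem coeff_add_onesHat_calI (P : Fin 3 → MvPolynomial (Fin 3) ℂ) {j : Fin 3}
    {α : Fin 3 →₀ ℕ} (hα : α j = 0) :
    coeff (α + onesHat j) (calI P) = coeff α (P j) * ∏ i, (Nat.factorial (α i) : ℂ) := by
  simp only [calI, coeff_sum, coeff_monomial]
  rw [Finset.sum_eq_single j]
  · simp only [add_left_inj, Finset.sum_ite_eq', Finset.mem_filter, mem_support_iff, hα,
      and_true, ite_not]
    split_ifs with h <;> simp [h]
  · refine fun i _ hij => Finset.sum_eq_zero fun β hβ => if_neg fun h => ?_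
    have := DFunLike.congr_fun h i
    simp [onesHat_apply, (Finset.mem_filter.1 hβ).2, hij] at this
  · simp

theorem coeff_eq_zero_of_sigma3_dvd_calI {P : Fin 3 → MvPolynomial (Fin 3) ℂ}
    (hdvd : sigma3 ∣ calI P) {j : Fin 3} {α : Fin 3 →₀ ℕ} (hα : α j = 0)
    (heven : ∀ i, Even (α i)) : coeff α (P j) = 0 := by
  obtain ⟨k, l, hjk, hjl, hkl⟩ : ∃ k l : Fin 3, j ≠ k ∧ j ≠ l ∧ k ≠ l := by
    clear hα; revert j; decide
  have hcover : ∀ i, i = j ∨ i = k ∨ i = l := by clear hα; revert j k l; decide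
  obtain ⟨Q, hQ⟩ := hdvd
  have h := coeff_sigma3_mul_eq_zero hjk hjl hkl Q (fun m _ hk hl hj => by
      rw [← hQ]
      refine coeff_calI_eq_zero P fun i => ?_
      rcases hcover i with rfl | rfl | rfl
      exacts [hj, hk.pos, hl.pos])
    (α + onesHat j) (by simp [onesHat_apply, hα])
    (by simpa [onesHat_apply, hjk.symm] using (heven k).add_one)
    (by simpa [onesHat_apply, hjl.symm] using (heven l).add_one)
  rw [← hQ, coeff_add_onesHat_calI P hα] at h
  refine (mul_eq_zero.1 h).resolve_right (Finset.prod_ne_zero_iff.2 fun i _ => ?_)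
  exact_mod_cast Nat.factorial_ne_zero _

/-- A harmonic polynomial is determined, on even multi-indices, by its coefficients
without the variable `j`. -/
theorem coeff_eq_zero_of_harmonic {p : MvPolynomial (Fin 3) ℂ}
    (hp : ∑ l : Fin 3, pderiv l (pderiv l p) = 0) (j : Fin 3)
    (h0 : ∀ α : Fin 3 →₀ ℕ, α j = 0 → (∀ i, Even (α i)) → coeff α p = 0)
    (α : Fin 3 →₀ ℕ) (heven : ∀ i, Even (α i)) : coeff α p = 0 := by
  induction hn : α j using Nat.strong_induction_on generalizing α with
  | _ n ih =>
    rcases Nat.eq_zero_or_pos (α j) with hα | hα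
    · exact h0 α hα heven
    have hα2 : 2 ≤ α j := by
      obtain ⟨r, hr⟩ := heven j
      omega
    obtain ⟨β, rfl⟩ : ∃ β, α = β + Finsupp.single j 1 + Finsupp.single j 1 := by
      refine ⟨α - Finsupp.single j 2, ?_⟩
      rw [add_assoc, ← Finsupp.single_add, tsub_add_cancel_of_le]
      simpa using hα2
    have hβ : ∀ i, Even (β i) := fun i => by
      have := heven i
      by_cases hij : j = i
      · subst hij
        simpa [add_assoc, parity_simps] using this
      · simpa [Finsupp.single_apply, hij] using this
    have h := congrArg (coeff β) hp
    simp only [coeff_sum, coeff_pderiv, coeff_zero] at h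
    rw [Finset.sum_eq_single j] at h
    · rw [mul_assoc] at h
      refine (mul_eq_zero.1 h).resolve_right (mul_ne_zero ?_ ?_) <;> norm_cast
    · intro i _ hij
      rw [ih (β j) _ (β + Finsupp.single i 1 + Finsupp.single i 1)]
      · simp
      · intro a
        by_cases hia : i = a
        · subst hia
          simpa [add_assoc, parity_simps] using hβ i
        · simpa [Finsupp.single_apply, hia] using hβ a
      · simp [hij]
      · simp at hn
        omega
    · simp

/-- for even `N ≥ 2` and `P` a divergence-free, curl-free, componentwise
harmonic 3-dimensional homogeneous polynomial of degree `N` with `σ ∣ 𝓘[P]`, all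
coefficients `p⁽ʲ⁾_{(2l,2n,N−2l−2n)}` with `l + n ≤ N/2` vanish. -/
theorem even_multiindex_coeff_vanish (N : ℕ) (hN : 2 ≤ N) (heven : Even N)
    (P : Fin 3 → MvPolynomial (Fin 3) ℂ)
    (hhom : ∀ j, (P j).IsHomogeneous N)
    (hdiv : ∑ j : Fin 3, pderiv j (P j) = 0)
    (hcurl : ∀ j l : Fin 3, pderiv l (P j) = pderiv j (P l))
    (hharm : ∀ j : Fin 3, ∑ l : Fin 3, pderiv l (pderiv l (P j)) = 0)
    (hdvd : sigma3 ∣ calI P) :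
    ∀ j : Fin 3, ∀ l n : ℕ, l + n ≤ N / 2 →
      coeff (Finsupp.single 0 (2 * l) + Finsupp.single 1 (2 * n) +
          Finsupp.single 2 (N - 2 * l - 2 * n)) (P j) = 0 := by
  intro j l n _
  refine coeff_eq_zero_of_harmonic (hharm j) j
    (fun α hα he => coeff_eq_zero_of_sigma3_dvd_calI hdvd hα he) _ fun i => ?_
  obtain ⟨r, rfl⟩ := heven
  rw [Nat.even_iff]
  simp only [Finsupp.add_apply, Finsupp.single_apply]
  split_ifs <;> omega
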